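/- Let Δ be an N×N real anti-symmetric matrix (Δᵀ = -Δ), let Δ̃ be its complexification, and let T be the 2N×2N complex block matrix T = fromBlocks ((1/2)•1) Δ̃ Δ̃ᴴ ((-1/2)•1). If i·ε (with ε ∈ ℝ) is an eigenvalue of Δ̃, then both √(1/4 + ε²) and -√(1/4 + ε²) are eigenvalues of T. -/

import Mathlib

open Matrix

theorem Matrix.mem_spectrum_iff_exists_mulVec_eq_smul {n K : Type*} [Fintype n] [DecidableEq n]
    [Field K] {M : Matrix n n K} {z : K} :
    z ∈ spectrum K M ↔ ∃ v ≠ 0, M *ᵥ v = z • v := by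
  rw [spectrum.mem_iff, Matrix.isUnit_iff_isUnit_det, isUnit_iff_ne_zero, not_not,
    ← Matrix.exists_mulVec_eq_zero_iff]
  simp only [Matrix.sub_mulVec, Algebra.algebraMap_eq_smul_one, Matrix.smul_mulVec, Matrix.one_mulVec,
    sub_eq_zero, eq_comm]

/-- An eigenvalue `μ` of `A` and a root `z` of `z ^ 2 = c ^ 2 - μ ^ 2` give an eigenvalue `z` of
`[[c, A], [-A, -c]]`. -/
theorem Matrix.mem_spectrum_fromBlocks_smul_one_neg {n K : Type*} [Fintype n] [DecidableEq n]
    [Field K] [NeZero (2 : K)] {A : Matrix n n K} {c μ z : K} (hc : c ≠ 0)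
    (hμ : μ ∈ spectrum K A) (hz : z ^ 2 = c ^ 2 - μ ^ 2) :
    z ∈ spectrum K (Matrix.fromBlocks (c • 1) A (-A) ((-c) • 1)) := by
  obtain ⟨v, hv, hAv⟩ := Matrix.mem_spectrum_iff_exists_mulVec_eq_smul.1 hμ
  have key : ∀ a b : K, c * a + μ * b = z * a → -(μ * a) - c * b = z * b → (a ≠ 0 ∨ b ≠ 0) →
      z ∈ spectrum K (Matrix.fromBlocks (c • 1) A (-A) ((-c) • 1)) := by
    intro a b h₁ h₂ hab
    refine Matrix.mem_spectrum_iff_exists_mulVec_eq_smul.2 ⟨Sum.elim (a • v) (b • v), ?_, ?_⟩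
    · intro h
      have ha : a • v = 0 := funext fun i => congrFun h (Sum.inl i)
      have hb : b • v = 0 := funext fun i => congrFun h (Sum.inr i)
      rcases hab with hab | hab
      · exact (smul_ne_zero hab hv) ha
      · exact (smul_ne_zero hab hv) hb
    · rw [Matrix.fromBlocks_mulVec]
      ext (i | i)
      · simp [Matrix.smul_mulVec, Matrix.mulVec_smul, hAv]
        linear_combination v i * h₁
      · simp [Matrix.smul_mulVec, Matrix.mulVec_smul, Matrix.neg_mulVec, hAv]
        linear_combination v i * h₂
  by_cases h : z + c = 0
  · refine key μ (z - c) (by ring) (by linear_combination -hz) (Or.inr fun h' => ?_)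
    have : 2 * c = 0 := by linear_combination h - h'
    exact mul_ne_zero two_ne_zero hc this
  · exact key (z + c) (-μ) (by linear_combination -hz) (by ring) (Or.inl h)

/-- Let `Δ` be a real anti-symmetric matrix with complexification `Δ̃`, and
`T = [[(1/2)·1, Δ̃], [Δ̃ᴴ, -(1/2)·1]]`. If `i·ε` (with `ε` real) is an eigenvalue of `Δ̃`,
then both `√(1/4 + ε²)` and `-√(1/4 + ε²)` are eigenvalues of `T`. -/
theorem single_fermion_excitation_energies (N : ℕ)
    (Δ : Matrix (Fin N) (Fin N) ℝ) (hΔ : Δᵀ = -Δ)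
    (T : Matrix (Fin N ⊕ Fin N) (Fin N ⊕ Fin N) ℂ)
    (hT : T = Matrix.fromBlocks (((1 : ℂ) / 2) • 1) (Δ.map Complex.ofReal)
      (Δ.map Complex.ofReal)ᴴ ((-(1 : ℂ) / 2) • 1))
    (ε : ℝ) (hε : Complex.I * (ε : ℂ) ∈ spectrum ℂ (Δ.map Complex.ofReal)) :
    ((Real.sqrt (1 / 4 + ε ^ 2) : ℝ) : ℂ) ∈ spectrum ℂ T ∧
      ((-Real.sqrt (1 / 4 + ε ^ 2) : ℝ) : ℂ) ∈ spectrum ℂ T := by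
  have hH : (Δ.map Complex.ofReal)ᴴ = -Δ.map Complex.ofReal := by
    ext i j
    have h := congrFun (congrFun hΔ i) j
    simp only [Matrix.transpose_apply, Matrix.neg_apply] at h
    simp [h]
  have hsq : Real.sqrt (1 / 4 + ε ^ 2) ^ 2 = 1 / 4 + ε ^ 2 := Real.sq_sqrt (by positivity)
  have key : ∀ r : ℝ, r ^ 2 = 1 / 4 + ε ^ 2 → (r : ℂ) ∈ spectrum ℂ T := by
    intro r hr
    have hr' : (r : ℂ) ^ 2 = 1 / 4 + (ε : ℂ) ^ 2 := by
      simpa using congrArg Complex.ofReal hr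
    rw [hT, hH, neg_div]
    refine Matrix.mem_spectrum_fromBlocks_smul_one_neg (by norm_num) hε ?_
    linear_combination hr' + (ε : ℂ) ^ 2 * Complex.I_sq
  exact ⟨key _ hsq, key _ (by rw [neg_sq, hsq])⟩
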